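/- arXiv:2602.05744 — 2 statements merged into one kernel-verified Lean document; each statement's English description precedes it below -/
import Mathlib

section
/- Let K ≥ 3 be an odd integer and let α ∈ (1,2]. Then the infimum of 2·D_α(p‖q)/‖p−q‖₁² over all pairs p ≠ q in relint(Δ^K) equals K^{1−α}·σ_{α,K}, where σ_{α,K} = ( ((1−1/K)^{(1−α)/(3−α)} + (1+1/K)^{(1−α)/(3−α)})/2 )^{3−α}. In particular, K^{1−α}·σ_{α,K} is the largest constant C ≥ 0 such that D_α(p‖q) ≥ (C/2)·‖p−q‖₁² holds for all p, q ∈ relint(Δ^K). -/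
open Finset Real

/-- The α-Tsallis entropy on the positive orthant (Shannon for α = 1, Burg for α = 0). -/
noncomputable def tsallis (α : ℝ) {K : ℕ} (p : Fin K → ℝ) : ℝ :=
  if α = 0 then ∑ k, Real.log (p k)
  else if α = 1 then -∑ k, p k * Real.log (p k)
  else (∑ k, p k ^ α) / (α * (1 - α))

/-- The gradient of the α-Tsallis entropy on the positive orthant. -/
noncomputable def tsallisGrad (α : ℝ) {K : ℕ} (q : Fin K → ℝ) (k : Fin K) : ℝ :=
  if α = 0 then 1 / q k
  else if α = 1 then -(1 + Real.log (q k))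
  else -(q k ^ (α - 1)) / (α - 1)

/-- The Bregman divergence D_α of the negative α-Tsallis entropy:
`D_α(p‖q) = -S_α(p) + S_α(q) + ⟨∇S_α(q), p - q⟩`. -/
noncomputable def breg (α : ℝ) {K : ℕ} (p q : Fin K → ℝ) : ℝ :=
  -tsallis α p + tsallis α q + ∑ k, tsallisGrad α q k * (p k - q k)

/-- The relative interior of the probability simplex Δ^K. -/
def relintSimplex (K : ℕ) : Set (Fin K → ℝ) :=
  {p | (∀ k, 0 < p k ∧ p k < 1) ∧ ∑ k, p k = 1}

/-- The ℓ¹ norm on ℝ^K. -/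
noncomputable def l1 {K : ℕ} (x : Fin K → ℝ) : ℝ := ∑ k, |x k|

open Filter Topology

theorem convexOn_rpow_Ioi_of_nonpos {γ : ℝ} (hγ : γ ≤ 0) :
    ConvexOn ℝ (Set.Ioi 0) fun x : ℝ ↦ x ^ γ := by
  refine convexOn_of_hasDerivWithinAt2_nonneg (f' := fun x ↦ γ * x ^ (γ - 1))
    (f'' := fun x ↦ γ * ((γ - 1) * x ^ (γ - 1 - 1))) (convex_Ioi 0)
    (fun x hx ↦ (continuousAt_rpow_const x γ (Or.inl hx.ne')).continuousWithinAt) ?_ ?_ ?_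
  all_goals
    intro x hx
    rw [interior_Ioi] at hx
    have hx' : (0 : ℝ) < x := hx
  · exact (hasDerivAt_rpow_const (Or.inl hx'.ne')).hasDerivWithinAt
  · exact ((hasDerivAt_rpow_const (Or.inl hx'.ne')).const_mul γ).hasDerivWithinAt
  · have := rpow_nonneg hx'.le (γ - 1 - 1)
    nlinarith [mul_nonneg (mul_nonneg (neg_nonneg.2 hγ) (by linarith : 0 ≤ 1 - γ)) this]

/-- For a convex function, moving two points apart while preserving their sum increases the sum
of the values. -/
theorem ConvexOn.add_le_add_of_mem_Icc {s : Set ℝ} {f : ℝ → ℝ} (hf : ConvexOn ℝ s f)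
    {a b x y : ℝ} (ha : a ∈ s) (hb : b ∈ s) (hax : a ≤ x) (hxb : x ≤ b) (hsum : a + b = x + y) :
    f x + f y ≤ f a + f b := by
  rcases eq_or_lt_of_le (hax.trans hxb) with hab | hab
  · obtain rfl : x = a := by linarith
    obtain rfl : y = b := by linarith
    rfl
  have hba : 0 < b - a := sub_pos.2 hab
  have hw₁ : 0 ≤ (b - x) / (b - a) := div_nonneg (by linarith) hba.le
  have hw₂ : 0 ≤ (x - a) / (b - a) := div_nonneg (by linarith) hba.le
  have hw : (b - x) / (b - a) + (x - a) / (b - a) = 1 := by field_simp; ring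
  have h₁ := hf.2 ha hb hw₁ hw₂ hw
  have h₂ := hf.2 ha hb hw₂ hw₁ (by rw [add_comm]; exact hw)
  have e₁ : (b - x) / (b - a) * a + (x - a) / (b - a) * b = x := by field_simp; ring
  have e₂ : (x - a) / (b - a) * a + (b - x) / (b - a) * b = y := by
    obtain rfl : y = a + b - x := by linarith
    field_simp; ring
  simp only [smul_eq_mul] at h₁ h₂
  rw [e₁] at h₁
  rw [e₂] at h₂
  have : f a + f b = ((b - x) / (b - a) + (x - a) / (b - a)) * (f a + f b) := by rw [hw, one_mul]
  rw [this]
  linarith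

theorem rpow_add_rpow_succ_le {γ : ℝ} (hγ : γ ≤ 0) {j m n : ℕ} (hm : 0 < m) (hn : 0 < n)
    (hmn : m + n = 2 * j + 1) :
    (j : ℝ) ^ γ + ((j : ℝ) + 1) ^ γ ≤ (m : ℝ) ^ γ + (n : ℝ) ^ γ := by
  have hsum : (m : ℝ) + n = j + (j + 1) := by
    have : ((m + n : ℕ) : ℝ) = ((2 * j + 1 : ℕ) : ℝ) := congrArg _ hmn
    push_cast at this
    linarith
  have hf := convexOn_rpow_Ioi_of_nonpos hγ
  have hm' : (m : ℝ) ∈ Set.Ioi (0 : ℝ) := Set.mem_Ioi.2 (Nat.cast_pos.2 hm)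
  have hn' : (n : ℝ) ∈ Set.Ioi (0 : ℝ) := Set.mem_Ioi.2 (Nat.cast_pos.2 hn)
  rcases le_or_gt m j with h | h
  · have h₁ : (m : ℝ) ≤ j := Nat.cast_le.2 h
    have h₂ : (j : ℝ) ≤ n := Nat.cast_le.2 (by omega)
    exact hf.add_le_add_of_mem_Icc hm' hn' h₁ h₂ hsum
  · have h₁ : (n : ℝ) ≤ j := Nat.cast_le.2 (by omega)
    have h₂ : (j : ℝ) ≤ m := Nat.cast_le.2 h.le
    rw [add_comm ((m : ℝ) ^ γ)]
    exact hf.add_le_add_of_mem_Icc hn' hm' h₁ h₂ (by rw [add_comm]; exact hsum)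

theorem sum_rpow_le_card_rpow_mul {ι : Type*} {A : Finset ι} (hA : A.Nonempty) {x : ι → ℝ}
    (hx : ∀ k ∈ A, 0 < x k) {α : ℝ} (hα1 : 1 < α) (hα2 : α ≤ 2) :
    ∑ k ∈ A, x k ^ (2 - α) ≤ (#A : ℝ) ^ (α - 1) * (∑ k ∈ A, x k) ^ (2 - α) := by
  have hc : (0 : ℝ) < #A := Nat.cast_pos.2 hA.card_pos
  have h := (concaveOn_rpow (p := 2 - α) (by linarith) (by linarith)).le_map_sum
    (t := A) (w := fun _ ↦ (#A : ℝ)⁻¹) (p := x) (fun _ _ ↦ (inv_pos.2 hc).le)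
    (by simp [hc.ne']) (fun k hk ↦ (hx k hk).le)
  simp only [smul_eq_mul, ← mul_sum] at h
  have hs : 0 < ∑ k ∈ A, x k := sum_pos hx hA
  rw [mul_rpow (inv_pos.2 hc).le hs.le, inv_rpow hc.le, inv_mul_le_iff₀ hc] at h
  refine h.trans_eq ?_
  rw [← mul_assoc, ← rpow_neg hc.le]
  congr 1
  nth_rewrite 1 [← rpow_one (#A : ℝ)]
  rw [← rpow_add hc]
  congr 1; ring

theorem sq_sum_mul_le_sum_sq_mul_rpow {ι : Type*} {A : Finset ι} (hA : A.Nonempty) {x : ι → ℝ}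
    (hx : ∀ k ∈ A, 0 < x k) (h : ι → ℝ) {α : ℝ} (hα1 : 1 < α) (hα2 : α ≤ 2) :
    (∑ k ∈ A, h k) ^ 2 * ((#A : ℝ) ^ (1 - α) * (∑ k ∈ A, x k) ^ (α - 2)) ≤
      ∑ k ∈ A, h k ^ 2 * x k ^ (α - 2) := by
  have hc : (0 : ℝ) < #A := Nat.cast_pos.2 hA.card_pos
  have hs : 0 < ∑ k ∈ A, x k := sum_pos hx hA
  have hS : 0 < ∑ k ∈ A, x k ^ (2 - α) := sum_pos (fun k hk ↦ rpow_pos_of_pos (hx k hk) _) hA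
  calc (∑ k ∈ A, h k) ^ 2 * ((#A : ℝ) ^ (1 - α) * (∑ k ∈ A, x k) ^ (α - 2))
      = (∑ k ∈ A, h k) ^ 2 / ((#A : ℝ) ^ (α - 1) * (∑ k ∈ A, x k) ^ (2 - α)) := by
        rw [div_eq_mul_inv, mul_inv, ← rpow_neg hc.le, ← rpow_neg hs.le, neg_sub, neg_sub]
    _ ≤ (∑ k ∈ A, h k) ^ 2 / ∑ k ∈ A, x k ^ (2 - α) :=
        div_le_div_of_nonneg_left (sq_nonneg _) hS (sum_rpow_le_card_rpow_mul hA hx hα1 hα2)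
    _ ≤ ∑ k ∈ A, h k ^ 2 / x k ^ (2 - α) :=
        sq_sum_div_le_sum_sq_div A h fun k hk ↦ rpow_pos_of_pos (hx k hk) _
    _ = ∑ k ∈ A, h k ^ 2 * x k ^ (α - 2) := sum_congr rfl fun k hk ↦ by
        rw [div_eq_mul_inv, ← rpow_neg (hx k hk).le, neg_sub]

theorem mul_div_rpow_eq {α m s : ℝ} (hα : α < 3) (hm : 0 < m) (hs : 0 < s) :
    s * (m ^ ((1 - α) / (3 - α)) / s) ^ (3 - α) = m ^ (1 - α) * s ^ (α - 2) := by
  rw [div_rpow (rpow_nonneg hm.le _) hs.le, ← rpow_mul hm.le,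
    div_mul_cancel₀ _ (by linarith : (3 : ℝ) - α ≠ 0), div_eq_mul_inv, ← rpow_neg hs.le,
    mul_left_comm]
  nth_rewrite 1 [← rpow_one s]
  rw [← rpow_add hs]
  congr 2; ring

theorem rpow_add_rpow_rpow_le {α m n s t : ℝ} (hα2 : α ≤ 2)
    (hm : 0 < m) (hn : 0 < n) (hs : 0 < s) (ht : 0 < t) (hst : s + t = 1) :
    (m ^ ((1 - α) / (3 - α)) + n ^ ((1 - α) / (3 - α))) ^ (3 - α) ≤
      m ^ (1 - α) * s ^ (α - 2) + n ^ (1 - α) * t ^ (α - 2) := by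
  have h := (convexOn_rpow (p := 3 - α) (by linarith)).2
    (x := m ^ ((1 - α) / (3 - α)) / s) (y := n ^ ((1 - α) / (3 - α)) / t)
    (div_nonneg (rpow_nonneg hm.le _) hs.le) (div_nonneg (rpow_nonneg hn.le _) ht.le)
    hs.le ht.le hst
  simp only [smul_eq_mul] at h
  rwa [mul_div_cancel₀ _ hs.ne', mul_div_cancel₀ _ ht.ne',
    mul_div_rpow_eq (by linarith) hm hs, mul_div_rpow_eq (by linarith) hn ht] at h

/-- The sharp lower bound for the Hessian quadratic form of `-S_α` on the simplex. -/
theorem sq_l1_le_sum_sq_mul_rpow {j : ℕ} {α : ℝ} (hα1 : 1 < α) (hα2 : α ≤ 2) (hj : 0 < j)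
    {x h : Fin (2 * j + 1) → ℝ} (hx : ∀ k, 0 < x k) (hx1 : ∑ k, x k = 1) (hh : ∑ k, h k = 0) :
    ((j : ℝ) ^ ((1 - α) / (3 - α)) + ((j : ℝ) + 1) ^ ((1 - α) / (3 - α))) ^ (3 - α) / 4 *
      l1 h ^ 2 ≤ ∑ k, h k ^ 2 * x k ^ (α - 2) := by
  have hγ : (1 - α) / (3 - α) ≤ 0 := div_nonpos_of_nonpos_of_nonneg (by linarith) (by linarith)
  by_cases h0 : h = 0
  · simp [h0, l1]
  set A := univ.filter fun k ↦ 0 < h k with hAdef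
  set B := univ.filter fun k ↦ ¬ 0 < h k with hBdef
  have split (f : Fin (2 * j + 1) → ℝ) : ∑ k ∈ A, f k + ∑ k ∈ B, f k = ∑ k, f k :=
    sum_filter_add_sum_filter_not _ _ _
  have hA : A.Nonempty := by
    by_contra hA
    rw [not_nonempty_iff_eq_empty, hAdef, filter_eq_empty_iff] at hA
    refine h0 (funext fun k ↦ ?_)
    have := (sum_eq_zero_iff_of_nonpos fun k _ ↦ not_lt.1 (hA (mem_univ k))).1 hh
    exact this k (mem_univ k)
  have hB : B.Nonempty := by
    by_contra hB
    rw [not_nonempty_iff_eq_empty, hBdef, filter_eq_empty_iff] at hB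
    exact (sum_pos (fun k _ ↦ not_not.1 (hB (mem_univ k))) univ_nonempty).ne' hh
  have hsA : ∑ k ∈ A, |h k| = ∑ k ∈ A, h k :=
    sum_congr rfl fun k hk ↦ abs_of_pos (mem_filter.1 hk).2
  have hsB : ∑ k ∈ B, |h k| = -∑ k ∈ B, h k := by
    rw [← sum_neg_distrib]
    exact sum_congr rfl fun k hk ↦ abs_of_nonpos (not_lt.1 (mem_filter.1 hk).2)
  have hl : l1 h = ∑ k ∈ A, |h k| + ∑ k ∈ B, |h k| := (split fun k ↦ |h k|).symm
  have hAB := split h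
  have hA2 : ∑ k ∈ A, h k = l1 h / 2 := by linarith
  have hB2 : ∑ k ∈ B, h k = -(l1 h / 2) := by linarith
  have qA := sq_sum_mul_le_sum_sq_mul_rpow hA (fun k _ ↦ hx k) h hα1 hα2
  have qB := sq_sum_mul_le_sum_sq_mul_rpow hB (fun k _ ↦ hx k) h hα1 hα2
  have hcard : #A + #B = 2 * j + 1 := 
    (card_filter_add_card_filter_not _).trans (by simp)
  have key := rpow_add_rpow_rpow_le (m := #A) (n := #B) hα2 (Nat.cast_pos.2 hA.card_pos)
    (Nat.cast_pos.2 hB.card_pos) (sum_pos (fun k _ ↦ hx k) hA) (sum_pos (fun k _ ↦ hx k) hB)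
    ((split x).trans hx1)
  have hj' : (0 : ℝ) < j := Nat.cast_pos.2 hj
  have mono : ((j : ℝ) ^ ((1 - α) / (3 - α)) + ((j : ℝ) + 1) ^ ((1 - α) / (3 - α))) ^ (3 - α) ≤
      ((#A : ℝ) ^ ((1 - α) / (3 - α)) + (#B : ℝ) ^ ((1 - α) / (3 - α))) ^ (3 - α) :=
    rpow_le_rpow (by positivity)
      (rpow_add_rpow_succ_le hγ hA.card_pos hB.card_pos hcard) (by linarith)
  rw [hA2] at qA
  rw [hB2] at qB
  rw [← split]
  have := mul_le_mul_of_nonneg_right (mono.trans key) (by positivity : 0 ≤ l1 h ^ 2 / 4)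
  linarith

theorem breg_eq_sum {α : ℝ} (hα : 1 < α) {K : ℕ} (p q : Fin K → ℝ) :
    breg α p q = ∑ k, p k ^ α / (α * (α - 1)) - ∑ k, q k ^ α / (α * (α - 1)) -
      ∑ k, q k ^ (α - 1) / (α - 1) * (p k - q k) := by
  have h0 : α ≠ 0 := by linarith
  have h1 : α - 1 ≠ 0 := by linarith
  have h2 : 1 - α ≠ 0 := by linarith
  have e (x : ℝ) : x / (α * (1 - α)) = -(x / (α * (α - 1))) := by
    rw [← div_neg]; congr 1; ring
  simp only [breg, tsallis, tsallisGrad, if_neg h0, if_neg hα.ne', e, neg_div, neg_mul,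
    sum_neg_distrib, sum_div]
  ring

theorem hasDerivAt_sum_rpow {α : ℝ} (hα : 1 < α) {K : ℕ} {q h : Fin K → ℝ} {t : ℝ}
    (hpos : ∀ k, 0 < q k + t * h k) :
    HasDerivAt (fun t ↦ ∑ k, (q k + t * h k) ^ α / (α * (α - 1)))
      (∑ k, (q k + t * h k) ^ (α - 1) / (α - 1) * h k) t := by
  have h0 : α ≠ 0 := by linarith
  have h1 : α - 1 ≠ 0 := by linarith
  refine HasDerivAt.fun_sum fun k _ ↦ ?_
  have hl : HasDerivAt (fun t ↦ q k + t * h k) (h k) t := by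
    simpa using ((hasDerivAt_id t).mul_const (h k)).const_add (q k)
  refine ((hl.rpow_const (p := α) (Or.inl (hpos k).ne')).div_const (α * (α - 1))).congr_deriv ?_
  field_simp

theorem hasDerivAt_sum_rpow_sub_one_mul {α : ℝ} (hα : 1 < α) {K : ℕ} {q h : Fin K → ℝ} {t : ℝ}
    (hpos : ∀ k, 0 < q k + t * h k) :
    HasDerivAt (fun t ↦ ∑ k, (q k + t * h k) ^ (α - 1) / (α - 1) * h k)
      (∑ k, h k ^ 2 * (q k + t * h k) ^ (α - 2)) t := by
  have h1 : α - 1 ≠ 0 := by linarith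
  refine HasDerivAt.fun_sum fun k _ ↦ ?_
  have hl : HasDerivAt (fun t ↦ q k + t * h k) (h k) t := by
    simpa using ((hasDerivAt_id t).mul_const (h k)).const_add (q k)
  refine (((hl.rpow_const (p := α - 1) (Or.inl (hpos k).ne')).div_const (α - 1)).mul_const
    (h k)).congr_deriv ?_
  rw [show α - 1 - 1 = α - 2 by ring]
  field_simp

theorem half_mul_sq_l1_le_breg {K : ℕ} {α C : ℝ} (hα : 1 < α)
    (hC : ∀ x h : Fin K → ℝ, (∀ k, 0 < x k) → ∑ k, x k = 1 → ∑ k, h k = 0 →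
      C * l1 h ^ 2 ≤ ∑ k, h k ^ 2 * x k ^ (α - 2))
    {p q : Fin K → ℝ} (hp : p ∈ relintSimplex K) (hq : q ∈ relintSimplex K) :
    C / 2 * l1 (p - q) ^ 2 ≤ breg α p q := by
  set h := p - q with hh
  have hsum : ∑ k, h k = 0 := by simp [hh, sum_sub_distrib, hp.2, hq.2]
  have hpos : ∀ t ∈ Set.Icc (0 : ℝ) 1, ∀ k, 0 < q k + t * h k := fun t ht k ↦ by
    have h₁ := (hp.1 k).1
    have h₂ := (hq.1 k).1
    simp only [hh, Pi.sub_apply]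
    rcases eq_or_lt_of_le ht.1 with rfl | h0
    · simpa using h₂
    · nlinarith [mul_pos h0 h₁, mul_nonneg (sub_nonneg.2 ht.2) h₂.le]
  have d₁ : ∀ t ∈ Set.Icc (0 : ℝ) 1, HasDerivAt
      (fun t ↦ ∑ k, (q k + t * h k) ^ α / (α * (α - 1)) - C / 2 * l1 h ^ 2 * t ^ 2)
      (∑ k, (q k + t * h k) ^ (α - 1) / (α - 1) * h k - C * l1 h ^ 2 * t) t := fun t ht ↦ by
    refine ((hasDerivAt_sum_rpow hα (hpos t ht)).sub
      ((hasDerivAt_pow 2 t).const_mul (C / 2 * l1 h ^ 2))).congr_deriv ?_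
    push_cast; ring
  have d₂ : ∀ t ∈ Set.Icc (0 : ℝ) 1, HasDerivAt
      (fun t ↦ ∑ k, (q k + t * h k) ^ (α - 1) / (α - 1) * h k - C * l1 h ^ 2 * t)
      (∑ k, h k ^ 2 * (q k + t * h k) ^ (α - 2) - C * l1 h ^ 2) t := fun t ht ↦ by
    refine ((hasDerivAt_sum_rpow_sub_one_mul hα (hpos t ht)).sub
      ((hasDerivAt_id t).const_mul (C * l1 h ^ 2))).congr_deriv ?_
    ring
  have hconv := convexOn_of_hasDerivWithinAt2_nonneg (convex_Icc (0 : ℝ) 1)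
    (fun t ht ↦ (d₁ t ht).continuousAt.continuousWithinAt)
    (fun t ht ↦ (d₁ t (interior_subset ht)).hasDerivWithinAt)
    (fun t ht ↦ (d₂ t (interior_subset ht)).hasDerivWithinAt)
    (fun t ht ↦ sub_nonneg.2 (hC _ h (hpos t (interior_subset ht))
      (by rw [sum_add_distrib, ← mul_sum, hsum, hq.2, mul_zero, add_zero]) hsum))
  have key := hconv.le_slope_of_hasDerivAt (by simp) (by simp) one_pos (d₁ 0 (by simp))
  rw [breg_eq_sum hα]
  simp only [slope_def_field, hh, Pi.sub_apply, zero_mul, add_zero, one_mul, add_sub_cancel,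
    mul_zero, sub_zero, div_one, one_pow, mul_one, ne_eq, OfNat.ofNat_ne_zero, not_false_eq_true,
    zero_pow] at key
  simp only [hh]
  linarith

theorem tendsto_breg_div_sq {α : ℝ} (hα : 1 < α) {K : ℕ} {q : Fin K → ℝ} (hq : ∀ k, 0 < q k)
    (h : Fin K → ℝ) :
    Tendsto (fun ε : ℝ ↦ breg α (fun k ↦ q k + ε * h k) q / ε ^ 2) (𝓝[≠] 0)
      (𝓝 ((∑ k, h k ^ 2 * q k ^ (α - 2)) / 2)) := by
  have hpos : ∀ᶠ ε in 𝓝 (0 : ℝ), ∀ k, 0 < q k + ε * h k := by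
    refine eventually_all.2 fun k ↦ ?_
    have : ContinuousAt (fun ε : ℝ ↦ q k + ε * h k) 0 := by fun_prop
    exact this.eventually_const_lt (by simpa using hq k)
  have hpos0 : ∀ k, 0 < q k + 0 * h k := hpos.self_of_nhds
  set G : ℝ → ℝ := fun ε ↦ ∑ k, (q k + ε * h k) ^ (α - 1) / (α - 1) * h k with hG
  have hderiv : ∀ᶠ ε in 𝓝 (0 : ℝ),
      HasDerivAt (fun ε ↦ breg α (fun k ↦ q k + ε * h k) q) (G ε - G 0) ε := by
    filter_upwards [hpos] with ε hε
    simp only [breg_eq_sum hα, add_sub_cancel_left]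
    refine ((hasDerivAt_sum_rpow hα hε).sub_const _).sub ?_
    refine (HasDerivAt.fun_sum (A' := fun k ↦ q k ^ (α - 1) / (α - 1) * h k)
      fun k _ ↦ ?_).congr_deriv ?_
    · simpa using ((hasDerivAt_id ε).mul_const (h k)).const_mul (q k ^ (α - 1) / (α - 1))
    · simp [hG]
  have hb0 : breg α (fun k ↦ q k + 0 * h k) q = 0 := by simp [breg_eq_sum hα]
  refine HasDerivAt.lhopital_zero_nhdsNE (f' := fun ε ↦ G ε - G 0) (g' := fun ε ↦ 2 * ε)
    (hderiv.filter_mono nhdsWithin_le_nhds)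
    (Eventually.of_forall fun ε ↦ by simpa using hasDerivAt_pow 2 ε) ?_ ?_ ?_ ?_
  · filter_upwards [self_mem_nhdsWithin] with ε hε
    exact mul_ne_zero two_ne_zero hε
  · have := hderiv.self_of_nhds.continuousAt.tendsto
    rw [hb0] at this
    exact this.mono_left nhdsWithin_le_nhds
  · have : ContinuousAt (fun ε : ℝ ↦ ε ^ 2) 0 := by fun_prop
    simpa using this.tendsto.mono_left (nhdsWithin_le_nhds (s := {0}ᶜ))
  · have hs := (hasDerivAt_sum_rpow_sub_one_mul hα hpos0).tendsto_slope
    simp only [zero_mul, add_zero] at hs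
    refine (hs.div_const 2).congr fun ε ↦ ?_
    rw [slope_def_field, sub_zero, div_div, mul_comm ε]

theorem mem_relintSimplex_of_pos {K : ℕ} (hK : 2 ≤ K) {p : Fin K → ℝ} (hp : ∀ k, 0 < p k)
    (hsum : ∑ k, p k = 1) : p ∈ relintSimplex K := by
  refine ⟨fun k ↦ ⟨hp k, ?_⟩, hsum⟩
  have : Nontrivial (Fin K) := Fin.nontrivial_iff_two_le.2 hK
  obtain ⟨i, hi⟩ := exists_ne k
  rw [← hsum]
  exact single_lt_sum hi (mem_univ k) (mem_univ i) (hp i) fun l _ _ ↦ (hp l).le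

theorem sum_ite_val_lt (j : ℕ) (a b : ℝ) :
    ∑ k : Fin (2 * j + 1), (if k.val < j then a else b) = j * a + (j + 1) * b := by
  rw [Fin.sum_univ_eq_sum_range (fun i ↦ if i < j then a else b),
    show 2 * j + 1 = j + (j + 1) by ring, sum_range_add,
    sum_congr rfl fun i hi ↦ if_pos (mem_range.1 hi)]
  simp

/-- A point of the simplex and a direction at which the Hessian bound is attained. -/
theorem exists_sum_sq_mul_rpow_eq {j : ℕ} {α : ℝ} (hα2 : α ≤ 2) (hj : 0 < j) :
    ∃ q h : Fin (2 * j + 1) → ℝ, (∀ k, 0 < q k) ∧ ∑ k, q k = 1 ∧ ∑ k, h k = 0 ∧ l1 h = 2 ∧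
      ∑ k, h k ^ 2 * q k ^ (α - 2) =
        ((j : ℝ) ^ ((1 - α) / (3 - α)) + ((j : ℝ) + 1) ^ ((1 - α) / (3 - α))) ^ (3 - α) := by
  have hj' : (0 : ℝ) < j := Nat.cast_pos.2 hj
  have hj1 : (0 : ℝ) < j + 1 := by linarith
  set u := (j : ℝ) ^ ((1 - α) / (3 - α)) with hu
  set v := ((j : ℝ) + 1) ^ ((1 - α) / (3 - α)) with hv
  have hu0 : 0 < u := rpow_pos_of_pos hj' _
  have hv0 : 0 < v := rpow_pos_of_pos hj1 _
  have hw : 0 < u + v := add_pos hu0 hv0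
  have e {m s : ℝ} (hm : 0 < m) (hs : 0 < s) :
      m * ((m⁻¹) ^ 2 * (s / m) ^ (α - 2)) = m ^ (1 - α) * s ^ (α - 2) := by
    have : m ^ (1 - α) = m ^ (-1 : ℝ) * m ^ (-(α - 2)) := by
      rw [← rpow_add hm]; congr 1; ring
    rw [this, rpow_neg_one, div_rpow hs.le hm.le, rpow_neg hm.le]
    field_simp
  have hs : 0 < u / (u + v) := div_pos hu0 hw
  have ht : 0 < v / (u + v) := div_pos hv0 hw
  refine ⟨fun k ↦ if k.val < j then u / (u + v) / j else v / (u + v) / (j + 1),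
    fun k ↦ if k.val < j then (j : ℝ)⁻¹ else -((j : ℝ) + 1)⁻¹, fun k ↦ ?_, ?_, ?_, ?_, ?_⟩
  · dsimp only
    split_ifs <;> positivity
  · rw [sum_ite_val_lt]
    field_simp
  · rw [sum_ite_val_lt]
    field_simp
    ring
  · simp only [l1, apply_ite abs, abs_neg, abs_of_pos (inv_pos.2 hj'), abs_of_pos (inv_pos.2 hj1)]
    rw [sum_ite_val_lt]
    field_simp
    norm_num
  · have : ∀ k : Fin (2 * j + 1), (if k.val < j then (j : ℝ)⁻¹ else -((j : ℝ) + 1)⁻¹) ^ 2 *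
        (if k.val < j then u / (u + v) / j else v / (u + v) / (j + 1)) ^ (α - 2) =
        if k.val < j then (j : ℝ)⁻¹ ^ 2 * (u / (u + v) / j) ^ (α - 2)
          else ((j : ℝ) + 1)⁻¹ ^ 2 * (v / (u + v) / (j + 1)) ^ (α - 2) := fun k ↦ by
      split_ifs <;> simp
    rw [sum_congr rfl fun k _ ↦ this k, sum_ite_val_lt, e hj' hs, e hj1 ht,
      ← mul_div_rpow_eq (by linarith) hj' hs, ← mul_div_rpow_eq (by linarith) hj1 ht, ← hu, ← hv,
      div_div_cancel₀ hu0.ne', div_div_cancel₀ hv0.ne', ← add_mul, ← add_div, div_self hw.ne',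
      one_mul]

theorem rpow_mul_rpow_mean_eq {j : ℕ} {α : ℝ} (hα2 : α ≤ 2) (hj : 0 < j) :
    ((2 * j + 1 : ℕ) : ℝ) ^ (1 - α) *
        (((1 - 1 / ((2 * j + 1 : ℕ) : ℝ)) ^ ((1 - α) / (3 - α))
            + (1 + 1 / ((2 * j + 1 : ℕ) : ℝ)) ^ ((1 - α) / (3 - α))) / 2) ^ (3 - α) =
      ((j : ℝ) ^ ((1 - α) / (3 - α)) + ((j : ℝ) + 1) ^ ((1 - α) / (3 - α))) ^ (3 - α) / 4 := by
  have hj' : (0 : ℝ) < j := Nat.cast_pos.2 hj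
  have hK : (0 : ℝ) < ((2 * j + 1 : ℕ) : ℝ) := by positivity
  set K : ℝ := ((2 * j + 1 : ℕ) : ℝ) with hKdef
  have hKj : K = 2 * j + 1 := by rw [hKdef]; push_cast; ring
  have e₁ : 1 - 1 / K = 2 / K * j := by
    field_simp; linarith
  have e₂ : 1 + 1 / K = 2 / K * (j + 1) := by
    field_simp; linarith
  have h3 : (3 : ℝ) - α ≠ 0 := by linarith
  rw [e₁, e₂, mul_rpow (by positivity) hj'.le, mul_rpow (by positivity) (by positivity), ← mul_add,
    div_rpow (by positivity) two_pos.le, mul_rpow (by positivity) (by positivity),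
    ← rpow_mul (by positivity), div_mul_cancel₀ _ h3, div_rpow two_pos.le hK.le]
  have h2 : (2 : ℝ) ^ (3 - α) = 2 ^ (1 - α) * 4 := by
    rw [show 3 - α = 1 - α + 2 by ring, rpow_add two_pos]
    norm_num
  have hKp := (rpow_pos_of_pos hK (1 - α)).ne'
  have h2p := (rpow_pos_of_pos (two_pos (α := ℝ)) (1 - α)).ne'
  rw [h2]
  field_simp

theorem pinsker_tsallis_odd_K (K : ℕ) (hK : 3 ≤ K) (hKodd : Odd K)
    (α : ℝ) (hα1 : 1 < α) (hα2 : α ≤ 2) :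
    sInf {r : ℝ | ∃ p ∈ relintSimplex K, ∃ q ∈ relintSimplex K,
        p ≠ q ∧ r = 2 * breg α p q / (l1 (p - q)) ^ 2} =
      (K : ℝ) ^ (1 - α) *
        (((1 - 1 / (K : ℝ)) ^ ((1 - α) / (3 - α))
            + (1 + 1 / (K : ℝ)) ^ ((1 - α) / (3 - α))) / 2) ^ (3 - α) ∧
    IsGreatest {C : ℝ | 0 ≤ C ∧ ∀ p ∈ relintSimplex K, ∀ q ∈ relintSimplex K,
        breg α p q ≥ C / 2 * (l1 (p - q)) ^ 2}
      ((K : ℝ) ^ (1 - α) *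
        (((1 - 1 / (K : ℝ)) ^ ((1 - α) / (3 - α))
            + (1 + 1 / (K : ℝ)) ^ ((1 - α) / (3 - α))) / 2) ^ (3 - α)) := by
  obtain ⟨j, rfl⟩ := hKodd
  have hj : 0 < j := by omega
  rw [rpow_mul_rpow_mean_eq hα2 hj]
  set c := ((j : ℝ) ^ ((1 - α) / (3 - α)) + ((j : ℝ) + 1) ^ ((1 - α) / (3 - α))) ^ (3 - α) / 4
    with hc
  set S := {r : ℝ | ∃ p ∈ relintSimplex (2 * j + 1), ∃ q ∈ relintSimplex (2 * j + 1),
    p ≠ q ∧ r = 2 * breg α p q / (l1 (p - q)) ^ 2} with hS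
  have lower : ∀ p ∈ relintSimplex (2 * j + 1), ∀ q ∈ relintSimplex (2 * j + 1),
      c / 2 * l1 (p - q) ^ 2 ≤ breg α p q := fun p hp q hq ↦
    half_mul_sq_l1_le_breg hα1
      (fun x h hx hx1 hh ↦ sq_l1_le_sum_sq_mul_rpow hα1 hα2 hj hx hx1 hh) hp hq
  have l1_pos {p q : Fin (2 * j + 1) → ℝ} (hpq : p ≠ q) : 0 < l1 (p - q) := by
    obtain ⟨k, hk⟩ := Function.ne_iff.1 hpq
    exact sum_pos' (fun i _ ↦ abs_nonneg _) ⟨k, mem_univ k, abs_pos.2 (sub_ne_zero.2 hk)⟩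
  obtain ⟨q, h, hq, hq1, hh, hl, hqh⟩ := exists_sum_sq_mul_rpow_eq (α := α) hα2 hj
  have hlim : Tendsto (fun ε : ℝ ↦ breg α (fun k ↦ q k + ε * h k) q / ε ^ 2 / 2) (𝓝[≠] 0)
      (𝓝 c) := by
    have := (tendsto_breg_div_sq hα1 hq h).div_const 2
    rw [hqh] at this
    rwa [hc, show (4 : ℝ) = 2 * 2 by norm_num, ← div_div]
  have hqm := mem_relintSimplex_of_pos (by omega) hq hq1
  have hmem : ∀ᶠ ε in 𝓝[≠] (0 : ℝ), breg α (fun k ↦ q k + ε * h k) q / ε ^ 2 / 2 ∈ S := by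
    have hpos : ∀ᶠ ε in 𝓝[≠] (0 : ℝ), ∀ k, 0 < q k + ε * h k := by
      refine (eventually_all.2 fun k ↦ ?_).filter_mono nhdsWithin_le_nhds
      have : ContinuousAt (fun ε : ℝ ↦ q k + ε * h k) 0 := by fun_prop
      exact this.eventually_const_lt (by simpa using hq k)
    filter_upwards [hpos, self_mem_nhdsWithin] with ε hε hε0
    have hε0 : ε ≠ 0 := hε0
    have hl1 : l1 ((fun k ↦ q k + ε * h k) - q) = |ε| * 2 := by
      rw [← hl]
      simp [l1, abs_mul, mul_sum]
    refine ⟨_, mem_relintSimplex_of_pos (by omega) hε ?_, q, hqm, fun heq ↦ ?_, ?_⟩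
    · rw [sum_add_distrib, ← mul_sum, hh, hq1, mul_zero, add_zero]
    · rw [heq, sub_self] at hl1
      simp [l1, hε0] at hl1
    · rw [hl1, mul_pow, sq_abs]
      field_simp
  have hglb : IsGLB S c := by
    refine ⟨?_, fun b hb ↦ ge_of_tendsto hlim (hmem.mono fun ε hε ↦ hb hε)⟩
    rintro _ ⟨p, hp, q, hq, hpq, rfl⟩
    rw [le_div_iff₀ (pow_pos (l1_pos hpq) 2)]
    linarith [lower p hp q hq]
  refine ⟨hglb.csInf_eq ?_, ⟨by positivity, lower⟩, fun C hC ↦ hglb.2 ?_⟩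
  · obtain ⟨ε, hε⟩ := hmem.exists
    exact ⟨_, hε⟩
  · rintro _ ⟨p, hp, q, hq, hpq, rfl⟩
    rw [le_div_iff₀ (pow_pos (l1_pos hpq) 2)]
    linarith [hC.2 p hp q hq]
end

section
/- Let K ≥ 2 be an integer, α ∈ ℝ, and let C_{α,K} be defined by: C_{α,K} = 2^{1−α} if α ≤ 1; C_{α,K} = K^{1−α} if α ∈ (1,2] and K is even; C_{α,K} = K^{1−α}·σ_{α,K} if α ∈ (1,2] and K is odd, where σ_{α,K} = ( ((1−1/K)^{(1−α)/(3−α)} + (1+1/K)^{(1−α)/(3−α)})/2 )^{3−α}; C_{α,K} = 2^{1−max{α,3}} if α > 2 and K = 2; and C_{α,K} = 0 if α > 2 and K ≥ 3. Then the function −S_α is C_{α,K}-strongly convex with respect to ‖·‖₁ on relint(Δ^K); that is, for all p, q ∈ relint(Δ^K) and all λ ∈ [0,1], −S_α(λp + (1−λ)q) ≤ −λ·S_α(p) − (1−λ)·S_α(q) − (C_{α,K}/2)·λ(1−λ)·‖p−q‖₁². -/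
open Finset Real

/-- The sharp Pinsker constant C_{α,K}. -/
noncomputable def sharpPinskerConst (α : ℝ) (K : ℕ) : ℝ :=
  if α ≤ 1 then (2 : ℝ) ^ (1 - α)
  else if α ≤ 2 then
    if Even K then (K : ℝ) ^ (1 - α)
    else (K : ℝ) ^ (1 - α) *
      (((1 - 1 / (K : ℝ)) ^ ((1 - α) / (3 - α))
          + (1 + 1 / (K : ℝ)) ^ ((1 - α) / (3 - α))) / 2) ^ (3 - α)
  else if K = 2 then (2 : ℝ) ^ (1 - max α 3)
  else 0

/-- The scalar function whose sum over the coordinates is the negative α-Tsallis entropy. -/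
noncomputable def negTsallisTerm (α x : ℝ) : ℝ :=
  if α = 0 then -Real.log x
  else if α = 1 then x * Real.log x
  else -(x ^ α / (α * (1 - α)))

/-- The derivative of `negTsallisTerm α` on the positive half-line. -/
noncomputable def negTsallisTermDeriv (α x : ℝ) : ℝ :=
  if α = 1 then Real.log x + 1 else -(x ^ (α - 1) / (1 - α))

lemma neg_tsallis_eq_sum (α : ℝ) {K : ℕ} (p : Fin K → ℝ) :
    -tsallis α p = ∑ k, negTsallisTerm α (p k) := by
  unfold tsallis negTsallisTerm
  split_ifs <;> simp [Finset.sum_div]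

lemma hasDerivAt_negTsallisTerm (α : ℝ) {x : ℝ} (hx : 0 < x) :
    HasDerivAt (negTsallisTerm α) (negTsallisTermDeriv α x) x := by
  unfold negTsallisTerm negTsallisTermDeriv
  by_cases h0 : α = 0
  · subst h0
    simpa [Real.rpow_neg_one] using (Real.hasDerivAt_log hx.ne').fun_neg
  by_cases h1 : α = 1
  · subst h1
    simpa using Real.hasDerivAt_mul_log hx.ne'
  · simp only [h0, h1, if_false]
    have h1' : 1 - α ≠ 0 := sub_ne_zero.mpr (Ne.symm h1)
    refine ((Real.hasDerivAt_rpow_const (p := α) (Or.inl hx.ne')).div_const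
      (α * (1 - α))).fun_neg.congr_deriv ?_
    field_simp

lemma hasDerivAt_negTsallisTermDeriv (α : ℝ) {x : ℝ} (hx : 0 < x) :
    HasDerivAt (negTsallisTermDeriv α) (x ^ (α - 2)) x := by
  unfold negTsallisTermDeriv
  by_cases h1 : α = 1
  · subst h1
    have : x ^ ((1 : ℝ) - 2) = x⁻¹ := by norm_num [Real.rpow_neg_one]
    simpa [this] using (Real.hasDerivAt_log hx.ne').add_const 1
  · simp only [h1, if_false]
    have h1' : 1 - α ≠ 0 := sub_ne_zero.mpr (Ne.symm h1)
    refine ((Real.hasDerivAt_rpow_const (p := α - 1) (Or.inl hx.ne')).div_const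
      (1 - α)).fun_neg.congr_deriv ?_
    rw [show α - 1 - 1 = α - 2 by ring]
    field_simp
    ring

lemma convexOn_rpow_of_nonpos {e : ℝ} (he : e ≤ 0) :
    ConvexOn ℝ (Set.Ioi 0) fun x : ℝ => x ^ e := by
  have hd : ∀ r : ℝ, ∀ x ∈ Set.Ioi (0 : ℝ), HasDerivAt (fun x : ℝ => x ^ r) (r * x ^ (r - 1)) x :=
    fun r x hx => Real.hasDerivAt_rpow_const (Or.inl (ne_of_gt hx))
  refine convexOn_of_hasDerivWithinAt2_nonneg (f' := fun x => e * x ^ (e - 1))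
    (f'' := fun x => e * ((e - 1) * x ^ (e - 1 - 1))) (convex_Ioi 0)
    (fun x hx => (hd e x hx).continuousAt.continuousWithinAt) ?_ ?_ ?_ <;>
    rw [interior_Ioi] <;> intro x hx
  · exact (hd e x hx).hasDerivWithinAt
  · exact ((hd (e - 1) x hx).const_mul e).hasDerivWithinAt
  · rw [← mul_assoc]
    exact mul_nonneg (mul_nonneg_of_nonpos_of_nonpos he (by linarith))
      (Real.rpow_nonneg (le_of_lt hx) _)

/-- Moving two points towards each other, keeping their sum, decreases the sum of the values of a
convex function. -/
lemma ConvexOn.add_le_add_of_add_eq {s : Set ℝ} {f : ℝ → ℝ} (hf : ConvexOn ℝ s f) {a b x y : ℝ}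
    (ha : a ∈ s) (hb : b ∈ s) (hax : a ≤ x) (hay : a ≤ y) (hsum : x + y = a + b) :
    f x + f y ≤ f a + f b := by
  rcases eq_or_lt_of_le (show a ≤ b by linarith) with h | h
  · obtain rfl : x = a := by linarith
    obtain rfl : y = b := by linarith
    rfl
  have hd : 0 < b - a := sub_pos.mpr h
  have hd' := hd.ne'
  have key : ∀ z w, a ≤ z → a ≤ w → z + w = a + b →
      f z ≤ (w - a) / (b - a) * f a + (z - a) / (b - a) * f b := by
    intro z w hz hw hzw
    obtain rfl : w = a + b - z := by linarith
    have := hf.2 ha hb (div_nonneg (by linarith : 0 ≤ a + b - z - a) hd.le)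
      (div_nonneg (by linarith : 0 ≤ z - a) hd.le) (by field_simp; ring)
    have hz : (a + b - z - a) / (b - a) * a + (z - a) / (b - a) * b = z := by
      field_simp
      ring
    rwa [smul_eq_mul, smul_eq_mul, hz] at this
  have h1 := key x y hax hay hsum
  have h2 := key y x hay hax (by linarith)
  have h3 : (y - a) / (b - a) + (x - a) / (b - a) = 1 := by
    rw [← add_div, div_eq_one_iff_eq hd']; linarith
  calc f x + f y ≤ ((y - a) / (b - a) + (x - a) / (b - a)) * f a
        + ((y - a) / (b - a) + (x - a) / (b - a)) * f b := by linarith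
    _ = f a + f b := by rw [h3]; ring

lemma rpow_add_rpow_le_of_balanced {e a b m n : ℝ} (he : e ≤ 0) (ha : 0 < a) (hb : 0 < b)
    (ham : a ≤ m) (han : a ≤ n) (hsum : a + b ≤ m + n) :
    m ^ e + n ^ e ≤ a ^ e + b ^ e := by
  have h1 := (convexOn_rpow_of_nonpos he).add_le_add_of_add_eq (a := a) (b := m + n - a) ha
    (show 0 < m + n - a by linarith) ham han (by ring)
  have h2 : (m + n - a) ^ e ≤ b ^ e := Real.rpow_le_rpow_of_nonpos hb (by linarith) he
  linarith

lemma rpow_sum_le_sum_mul_rpow {α : ℝ} (hα : α ≤ 2) {K : ℕ} (v r : Fin K → ℝ)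
    (hr : ∀ k, 0 < r k) (hr1 : ∑ k, r k = 1) :
    (∑ k, |v k| ^ (2 / (3 - α))) ^ (3 - α) ≤ ∑ k, v k ^ 2 * r k ^ (α - 2) := by
  have h3 : 3 - α ≠ 0 := by linarith
  have := Real.rpow_arith_mean_le_arith_mean_rpow univ r
    (fun k => |v k| ^ (2 / (3 - α)) / r k) (fun k _ => (hr k).le) hr1
    (fun k _ => div_nonneg (Real.rpow_nonneg (abs_nonneg _) _) (hr k).le) (p := 3 - α)
    (by linarith)
  refine (Eq.trans_le ?_ this).trans_eq ?_
  · exact congrArg (· ^ (3 - α)) <|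
      Finset.sum_congr rfl fun k _ => (mul_div_cancel₀ _ (hr k).ne').symm
  · refine Finset.sum_congr rfl fun k _ => ?_
    rw [Real.div_rpow (Real.rpow_nonneg (abs_nonneg _) _) (hr k).le,
      ← Real.rpow_mul (abs_nonneg _), div_mul_cancel₀ _ h3, Real.rpow_two, sq_abs,
      show α - 2 = 1 - (3 - α) by ring, Real.rpow_sub (hr k) 1, Real.rpow_one]
    ring

lemma rpow_sum_abs_le_sum_rpow {ι : Type*} (A : Finset ι) (v : ι → ℝ) {s : ℝ} (h0 : 0 < s)
    (h1 : s ≤ 1) : (∑ k ∈ A, |v k|) ^ s ≤ ∑ k ∈ A, |v k| ^ s := by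
  classical
  induction A using Finset.induction_on with
  | empty => simp [Real.zero_rpow h0.ne']
  | insert a A ha ih =>
    rw [Finset.sum_insert ha, Finset.sum_insert ha]
    have := Real.rpow_add_le_add_rpow (abs_nonneg (v a))
      (Finset.sum_nonneg fun k (_ : k ∈ A) => abs_nonneg (v k)) h0.le h1
    linarith

lemma card_rpow_mul_rpow_sum_le {ι : Type*} (A : Finset ι) (hA : A.Nonempty) (v : ι → ℝ) {s : ℝ}
    (h1 : 1 ≤ s) :
    (A.card : ℝ) ^ (1 - s) * (∑ k ∈ A, |v k|) ^ s ≤ ∑ k ∈ A, |v k| ^ s := by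
  have hc : (0 : ℝ) < A.card := by exact_mod_cast hA.card_pos
  calc (A.card : ℝ) ^ (1 - s) * (∑ k ∈ A, |v k|) ^ s
      ≤ (A.card : ℝ) ^ (1 - s) * ((A.card : ℝ) ^ (s - 1) * ∑ k ∈ A, |v k| ^ s) :=
        mul_le_mul_of_nonneg_left (Real.rpow_sum_le_const_mul_sum_rpow A v h1)
          (Real.rpow_nonneg hc.le _)
    _ = ∑ k ∈ A, |v k| ^ s := by
        rw [← mul_assoc, ← Real.rpow_add hc]; simp

section SignSplit

variable {K : ℕ} (v : Fin K → ℝ)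

lemma l1_nonneg : 0 ≤ l1 v := Finset.sum_nonneg fun _ _ => abs_nonneg _

lemma sum_abs_filter_add (g : ℝ → ℝ) (hg : g 0 = 0) :
    ∑ k with 0 < v k, g |v k| + ∑ k with v k < 0, g |v k| = ∑ k, g |v k| := by
  rw [Finset.sum_filter, Finset.sum_filter, ← Finset.sum_add_distrib]
  refine Finset.sum_congr rfl fun k _ => ?_
  rcases lt_trichotomy (v k) 0 with h | h | h
  · simp [h, h.le.not_gt]
  · simp [h, hg]
  · simp [h, h.le.not_gt]

lemma sum_abs_filter_pos_eq (hv : ∑ k, v k = 0) :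
    ∑ k with 0 < v k, |v k| = l1 v / 2 ∧ ∑ k with v k < 0, |v k| = l1 v / 2 := by
  have h1 : ∑ k with 0 < v k, |v k| + ∑ k with v k < 0, |v k| = l1 v :=
    sum_abs_filter_add v id rfl
  have h2 : ∑ k with 0 < v k, |v k| - ∑ k with v k < 0, |v k| = 0 := by
    refine Eq.trans ?_ hv
    rw [Finset.sum_filter, Finset.sum_filter, ← Finset.sum_sub_distrib]
    refine Finset.sum_congr rfl fun k _ => ?_
    rcases lt_trichotomy (v k) 0 with h | h | h
    · simp [h, h.le.not_gt, abs_of_neg]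
    · simp [h]
    · simp [h, h.le.not_gt, abs_of_pos]
  constructor <;> linarith

end SignSplit

lemma mul_sq_le_of_mul_rpow_le {α D V : ℝ} (hα : α ≤ 2) {K : ℕ} {v r : Fin K → ℝ}
    (hr : ∀ k, 0 < r k) (hr1 : ∑ k, r k = 1) (hD : 0 ≤ D) (hV : 0 ≤ V)
    (h : D * V ^ (2 / (3 - α)) ≤ ∑ k, |v k| ^ (2 / (3 - α))) :
    D ^ (3 - α) * V ^ 2 ≤ ∑ k, v k ^ 2 * r k ^ (α - 2) := by
  refine le_trans ?_ (rpow_sum_le_sum_mul_rpow hα v r hr hr1)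
  have h3 : 3 - α ≠ 0 := by linarith
  have hVs := Real.rpow_nonneg hV (2 / (3 - α))
  calc D ^ (3 - α) * V ^ 2 = (D * V ^ (2 / (3 - α))) ^ (3 - α) := by
        rw [Real.mul_rpow hD hVs, ← Real.rpow_mul hV, div_mul_cancel₀ _ h3, Real.rpow_two]
    _ ≤ _ := Real.rpow_le_rpow (mul_nonneg hD hVs) h (by linarith)

lemma quadratic_lower_bound_of_le_one {α : ℝ} (hα : α ≤ 1) {K : ℕ} {v r : Fin K → ℝ}
    (hr : ∀ k, 0 < r k) (hr1 : ∑ k, r k = 1) (hv : ∑ k, v k = 0) :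
    (2 : ℝ) ^ (1 - α) * l1 v ^ 2 ≤ ∑ k, v k ^ 2 * r k ^ (α - 2) := by
  have hs0 : 0 < 2 / (3 - α) := div_pos two_pos (by linarith)
  have hs1 : 2 / (3 - α) ≤ 1 := (div_le_one (by linarith)).2 (by linarith)
  obtain ⟨hp, hn⟩ := sum_abs_filter_pos_eq v hv
  have h1 := rpow_sum_abs_le_sum_rpow (univ.filter fun k => 0 < v k) v hs0 hs1
  have h2 := rpow_sum_abs_le_sum_rpow (univ.filter fun k => v k < 0) v hs0 hs1
  have h3 := sum_abs_filter_add v (fun x => x ^ (2 / (3 - α))) (Real.zero_rpow hs0.ne')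
  rw [hp] at h1
  rw [hn] at h2
  have key := mul_sq_le_of_mul_rpow_le (α := α) (D := 2) (V := l1 v / 2) (v := v) (by linarith)
    hr hr1 zero_le_two (by linarith [l1_nonneg v]) (by linarith)
  rw [show 3 - α = 1 - α + 2 by ring, Real.rpow_add two_pos, Real.rpow_two] at key
  linarith

lemma quadratic_lower_bound_of_le_two {α : ℝ} (h1α : 1 < α) (hα : α ≤ 2) {K m n : ℕ}
    (hmn : m + n = K) (hmn' : m ≤ n) (hnm : n ≤ m + 1) {v r : Fin K → ℝ}
    (hr : ∀ k, 0 < r k) (hr1 : ∑ k, r k = 1) (hv : ∑ k, v k = 0) :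
    ((m : ℝ) ^ ((1 - α) / (3 - α)) + (n : ℝ) ^ ((1 - α) / (3 - α))) ^ (3 - α) * (l1 v / 2) ^ 2 ≤
      ∑ k, v k ^ 2 * r k ^ (α - 2) := by
  have hs1 : 1 ≤ 2 / (3 - α) := (one_le_div (by linarith)).2 (by linarith)
  have he : 1 - 2 / (3 - α) = (1 - α) / (3 - α) := by
    have : 3 - α ≠ 0 := by linarith
    field_simp
    ring
  have he0 : (1 - α) / (3 - α) ≤ 0 := div_nonpos_of_nonpos_of_nonneg (by linarith) (by linarith)
  obtain ⟨hp, hn⟩ := sum_abs_filter_pos_eq v hv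
  have h3 := sum_abs_filter_add v (fun x => x ^ (2 / (3 - α))) (Real.zero_rpow (by linarith))
  have hL := l1_nonneg v
  rcases hL.eq_or_lt with h0 | hpos
  · rw [← h0]
    simp only [zero_div, ne_eq, OfNat.ofNat_ne_zero, not_false_eq_true, zero_pow, mul_zero]
    exact Finset.sum_nonneg fun k _ => mul_nonneg (sq_nonneg _) (Real.rpow_nonneg (hr k).le _)
  set A : Finset (Fin K) := univ.filter fun k => 0 < v k with hA
  set B : Finset (Fin K) := univ.filter fun k => v k < 0 with hB
  have hAne : A.Nonempty := Finset.nonempty_of_ne_empty fun h => by simp [h] at hp; linarith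
  have hBne : B.Nonempty := Finset.nonempty_of_ne_empty fun h => by simp [h] at hn; linarith
  have h1 := card_rpow_mul_rpow_sum_le A hAne v hs1
  have h2 := card_rpow_mul_rpow_sum_le B hBne v hs1
  rw [hp, he] at h1
  rw [hn, he] at h2
  have hdisj : Disjoint A B := by
    rw [Finset.disjoint_left]
    intro k hk hk'
    simp only [hA, hB, Finset.mem_filter, Finset.mem_univ, true_and] at hk hk'
    exact lt_asymm hk hk'
  have hcard : A.card + B.card ≤ K := by
    rw [← Finset.card_union_of_disjoint hdisj]
    simpa using Finset.card_le_univ (A ∪ B)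
  have hApos : (0 : ℝ) < A.card := by exact_mod_cast hAne.card_pos
  have hBpos : (0 : ℝ) < B.card := by exact_mod_cast hBne.card_pos
  have hcard' : (A.card : ℝ) + B.card ≤ m + n := by exact_mod_cast hcard.trans_eq hmn.symm
  have hbal : (m : ℝ) ^ ((1 - α) / (3 - α)) + (n : ℝ) ^ ((1 - α) / (3 - α)) ≤
      (A.card : ℝ) ^ ((1 - α) / (3 - α)) + (B.card : ℝ) ^ ((1 - α) / (3 - α)) := by
    rcases le_total A.card B.card with h | h
    · have : A.card ≤ m := by omega
      exact rpow_add_rpow_le_of_balanced he0 hApos hBpos (by exact_mod_cast this)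
        (by exact_mod_cast this.trans hmn') hcard'
    · have : B.card ≤ m := by omega
      rw [add_comm ((A.card : ℝ) ^ _)]
      exact rpow_add_rpow_le_of_balanced he0 hBpos hApos (by exact_mod_cast this)
        (by exact_mod_cast this.trans hmn') (by linarith)
  refine mul_sq_le_of_mul_rpow_le hα hr hr1
    (add_nonneg (Real.rpow_nonneg (Nat.cast_nonneg _) _) (Real.rpow_nonneg (Nat.cast_nonneg _) _))
    (by linarith) ?_
  have := mul_le_mul_of_nonneg_right hbal
    (Real.rpow_nonneg (by linarith : 0 ≤ l1 v / 2) (2 / (3 - α)))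
  linarith

lemma rpow_mul_rpow_mean_eq_s5 {α x y κ : ℝ} (hα : α < 3) (hκ : 0 < κ) (hx : 0 ≤ x) (hy : 0 ≤ y) :
    ((κ / 2 * x) ^ ((1 - α) / (3 - α)) + (κ / 2 * y) ^ ((1 - α) / (3 - α))) ^ (3 - α) =
      4 * (κ ^ (1 - α) *
        ((x ^ ((1 - α) / (3 - α)) + y ^ ((1 - α) / (3 - α))) / 2) ^ (3 - α)) := by
  have h3 : 3 - α ≠ 0 := (sub_pos.2 hα).ne'
  have hκ2 : 0 < κ / 2 := by linarith
  set e := (1 - α) / (3 - α) with he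
  have hX : 0 ≤ (x ^ e + y ^ e) / 2 :=
    div_nonneg (add_nonneg (Real.rpow_nonneg hx _) (Real.rpow_nonneg hy _)) zero_le_two
  have h4 : (2 : ℝ) ^ (3 - α) = 4 * 2 ^ (1 - α) := by
    rw [show 3 - α = 2 + (1 - α) by ring, Real.rpow_add two_pos, Real.rpow_two]
    norm_num
  have h2 : (2 : ℝ) ^ (1 - α) ≠ 0 := (Real.rpow_pos_of_pos two_pos _).ne'
  rw [Real.mul_rpow hκ2.le hx, Real.mul_rpow hκ2.le hy,
    show (κ / 2) ^ e * x ^ e + (κ / 2) ^ e * y ^ e = (κ / 2) ^ e * (2 * ((x ^ e + y ^ e) / 2)) by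
      ring,
    Real.mul_rpow (Real.rpow_nonneg hκ2.le _) (mul_nonneg zero_le_two hX),
    Real.mul_rpow zero_le_two hX, ← Real.rpow_mul hκ2.le, he, div_mul_cancel₀ _ h3,
    Real.div_rpow hκ.le zero_le_two, h4]
  field_simp

lemma quadratic_lower_bound_fin_two (α : ℝ) {v r : Fin 2 → ℝ}
    (hr : ∀ k, 0 < r k) (hr1 : ∑ k, r k = 1) (hv : ∑ k, v k = 0) :
    (2 : ℝ) ^ (1 - max α 3) * l1 v ^ 2 ≤ ∑ k, v k ^ 2 * r k ^ (α - 2) := by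
  simp only [Fin.sum_univ_two, l1] at *
  have h0 := hr 0
  have h1 := hr 1
  have hv1 : v 1 = -v 0 := by linarith
  rw [hv1, abs_neg, show (|v 0| + |v 0|) ^ 2 = 4 * v 0 ^ 2 by rw [← sq_abs (v 0)]; ring]
  have hmain : (2 : ℝ) ^ (1 - max α 3) * 4 ≤ r 0 ^ (α - 2) + r 1 ^ (α - 2) := by
    rcases le_total α 3 with h | h
    · rw [max_eq_right h]
      have e : ∀ k, r k ≤ 1 → r k ≤ r k ^ (α - 2) := fun k hk => by
        simpa using Real.rpow_le_rpow_of_exponent_ge (hr k) hk (show α - 2 ≤ 1 by linarith)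
      have := e 0 (by linarith)
      have := e 1 (by linarith)
      norm_num [show (1 : ℝ) - 3 = -2 by norm_num, Real.rpow_neg]
      linarith
    · rw [max_eq_left h]
      have hj := (convexOn_rpow (p := α - 2) (by linarith)).2 h0.le h1.le
        one_half_pos.le one_half_pos.le (add_halves 1)
      simp only [smul_eq_mul] at hj
      rw [← mul_add, hr1, mul_one, one_div, Real.inv_rpow zero_le_two, ← Real.rpow_neg zero_le_two,
        show -(α - 2) = 1 - α + 1 by ring, Real.rpow_add two_pos, Real.rpow_one] at hj
      linarith
  nlinarith [mul_le_mul_of_nonneg_right hmain (sq_nonneg (v 0))]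

/-- The Hessian of the negative Tsallis entropy dominates the sharp constant times the squared
ℓ¹ norm on directions tangent to the simplex. -/
lemma sharpPinskerConst_mul_sq_le {K : ℕ} (hK : 2 ≤ K) (α : ℝ) {v r : Fin K → ℝ}
    (hr : ∀ k, 0 < r k) (hr1 : ∑ k, r k = 1) (hv : ∑ k, v k = 0) :
    sharpPinskerConst α K * l1 v ^ 2 ≤ ∑ k, v k ^ 2 * r k ^ (α - 2) := by
  have hK0 : (0 : ℝ) < K := by exact_mod_cast (by omega : 0 < K)
  unfold sharpPinskerConst
  split_ifs with h1 h2 h3 h4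
  · exact quadratic_lower_bound_of_le_one h1 hr hr1 hv
  · obtain ⟨m, hm⟩ := h3
    have key := quadratic_lower_bound_of_le_two (not_le.mp h1) h2 hm.symm le_rfl (by omega)
      hr hr1 hv
    have hmK : (m : ℝ) = K / 2 * 1 := by rw [hm]; push_cast; ring
    rw [hmK, rpow_mul_rpow_mean_eq_s5 (by linarith) hK0 zero_le_one zero_le_one] at key
    norm_num at key
    linarith
  · obtain ⟨m, hm⟩ := Nat.not_even_iff_odd.mp h3
    have key := quadratic_lower_bound_of_le_two (m := m) (n := m + 1) (not_le.mp h1) h2 (by omega)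
      (by omega) le_rfl hr hr1 hv
    have hKm : (K : ℝ) = 2 * m + 1 := by rw [hm]; push_cast; rfl
    have hm1 : (m : ℝ) = K / 2 * (1 - 1 / K) := by field_simp; rw [hKm]; ring
    have hm2 : ((m + 1 : ℕ) : ℝ) = K / 2 * (1 + 1 / K) := by
      field_simp; push_cast; rw [hKm]; ring
    have hle : 1 / (K : ℝ) ≤ 1 := (div_le_one hK0).2 (by exact_mod_cast (by omega : 1 ≤ K))
    rw [hm1, hm2, rpow_mul_rpow_mean_eq_s5 (by linarith) hK0 (by linarith) (by positivity)] at key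
    linarith
  · subst h4
    exact quadratic_lower_bound_fin_two α hr hr1 hv
  · rw [zero_mul]
    exact Finset.sum_nonneg fun k _ => mul_nonneg (sq_nonneg _) (Real.rpow_nonneg (hr k).le _)

/-- A lower bound on the second derivative on `[0, 1]` gives a quadratic improvement in the
convexity inequality. -/
lemma le_sub_mul_of_le_second_deriv {g g' g'' : ℝ → ℝ} {M : ℝ}
    (hg : ∀ t ∈ Set.Icc (0 : ℝ) 1, HasDerivAt g (g' t) t)
    (hg' : ∀ t ∈ Set.Icc (0 : ℝ) 1, HasDerivAt g' (g'' t) t)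
    (hM : ∀ t ∈ Set.Icc (0 : ℝ) 1, M ≤ g'' t) {t : ℝ} (ht : t ∈ Set.Icc (0 : ℝ) 1) :
    g t ≤ t * g 1 + (1 - t) * g 0 - M / 2 * (t * (1 - t)) := by
  have d1 : ∀ x ∈ Set.Icc (0 : ℝ) 1,
      HasDerivAt (fun x => g x - M / 2 * x ^ 2) (g' x - M * x) x := fun x hx => by
    refine ((hg x hx).fun_sub ((hasDerivAt_pow 2 x).const_mul (M / 2))).congr_deriv ?_
    push_cast
    ring
  have d2 : ∀ x ∈ Set.Icc (0 : ℝ) 1,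
      HasDerivAt (fun x => g' x - M * x) (g'' x - M) x := fun x hx => by
    simpa using (hg' x hx).fun_sub ((hasDerivAt_id x).const_mul M)
  have hc : ConvexOn ℝ (Set.Icc (0 : ℝ) 1) fun x => g x - M / 2 * x ^ 2 :=
    convexOn_of_hasDerivWithinAt2_nonneg (convex_Icc 0 1)
      (fun x hx => (d1 x hx).continuousAt.continuousWithinAt)
      (fun x hx => (d1 x (interior_subset hx)).hasDerivWithinAt)
      (fun x hx => (d2 x (interior_subset hx)).hasDerivWithinAt)
      (fun x hx => sub_nonneg.2 (hM x (interior_subset hx)))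
  have := hc.2 (Set.right_mem_Icc.2 zero_le_one) (Set.left_mem_Icc.2 zero_le_one) ht.1
    (sub_nonneg.2 ht.2) (by ring)
  simp only [smul_eq_mul, mul_one, mul_zero, add_zero] at this
  linarith

theorem tsallis_strong_convexity (K : ℕ) (hK : 2 ≤ K) (α : ℝ) :
    ∀ p ∈ relintSimplex K, ∀ q ∈ relintSimplex K, ∀ t ∈ Set.Icc (0 : ℝ) 1,
      -tsallis α (fun k => t * p k + (1 - t) * q k) ≤
        -(t * tsallis α p) - (1 - t) * tsallis α q
          - sharpPinskerConst α K / 2 * (t * (1 - t)) * (l1 (p - q)) ^ 2 := by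
  rintro p ⟨hp, hp1⟩ q ⟨hq, hq1⟩ t ht
  have hpos : ∀ s ∈ Set.Icc (0 : ℝ) 1, ∀ k, 0 < s * p k + (1 - s) * q k := fun s hs k => by
    rcases hs.1.eq_or_lt with h | h
    · simpa [← h] using (hq k).1
    · exact add_pos_of_pos_of_nonneg (mul_pos h (hp k).1)
        (mul_nonneg (by linarith [hs.2]) (hq k).1.le)
  have hline : ∀ k s, HasDerivAt (fun s => s * p k + (1 - s) * q k) (p k - q k) s := fun k s => by
    refine (((hasDerivAt_id s).mul_const (p k)).fun_add
      (((hasDerivAt_id s).const_sub 1).mul_const (q k))).congr_deriv ?_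
    ring
  have key := le_sub_mul_of_le_second_deriv
    (g := fun s => ∑ k, negTsallisTerm α (s * p k + (1 - s) * q k))
    (g' := fun s => ∑ k, negTsallisTermDeriv α (s * p k + (1 - s) * q k) * (p k - q k))
    (g'' := fun s => ∑ k, (s * p k + (1 - s) * q k) ^ (α - 2) * (p k - q k) * (p k - q k))
    (M := sharpPinskerConst α K * l1 (p - q) ^ 2)
    (fun s hs => HasDerivAt.fun_sum fun k _ =>
      HasDerivAt.comp (h₂ := negTsallisTerm α) s
        (hasDerivAt_negTsallisTerm α (hpos s hs k)) (hline k s))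
    (fun s hs => HasDerivAt.fun_sum fun k _ =>
      (HasDerivAt.comp (h₂ := negTsallisTermDeriv α) s
        (hasDerivAt_negTsallisTermDeriv α (hpos s hs k)) (hline k s)).mul_const _)
    (fun s hs => by
      have := sharpPinskerConst_mul_sq_le hK α (v := p - q)
        (r := fun k => s * p k + (1 - s) * q k) (hpos s hs)
        (by rw [Finset.sum_add_distrib, ← Finset.mul_sum, ← Finset.mul_sum, hp1, hq1]; ring)
        (by simp [hp1, hq1])
      refine this.trans_eq (Finset.sum_congr rfl fun k _ => ?_)
      rw [Pi.sub_apply]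
      ring)
    ht
  rw [neg_tsallis_eq_sum]
  have hp' := neg_tsallis_eq_sum α p
  have hq' := neg_tsallis_eq_sum α q
  simp only [one_mul, sub_self, zero_mul, add_zero, sub_zero, zero_add] at key
  rw [← hp', ← hq'] at key
  linarith
end
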